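/- arXiv:math/0301090 — 8 statements merged into one kernel-verified Lean document; each statement's English description precedes it below -/
import Mathlib

section
/- If S and T are left Ore sets in a unital ring R, then the set of products ST = {st : s ∈ S, t ∈ T} (which in general is not multiplicatively closed) satisfies the left Ore condition in R: for every u ∈ ST and every r ∈ R there exist u' ∈ ST and r' ∈ R such that r'u = u'r. -/
/-- A multiplicative subset `S` of a unital ring `R` is a *left Ore set* if it satisfies
the left Ore condition and left reversibility. -/
structure IsLeftOreSet {R : Type*} [Ring R] (S : Set R) : Prop where
  one_mem : (1 : R) ∈ S
  mul_mem : ∀ ⦃s t : R⦄, s ∈ S → t ∈ S → s * t ∈ S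
  zero_not_mem : (0 : R) ∉ S
  ore : ∀ s ∈ S, ∀ r : R, ∃ s' ∈ S, ∃ r' : R, r' * s = s' * r
  reversible : ∀ (n : R), ∀ s ∈ S, n * s = 0 → ∃ s' ∈ S, s' * n = 0

/-- If `S` and `T` are left Ore sets in a unital ring `R`, then the set
`ST = {s * t : s ∈ S, t ∈ T}` of products satisfies the left Ore condition in `R`:
for every `u ∈ ST` and every `r ∈ R` there exist `u' ∈ ST` and `r' ∈ R`
with `r' * u = u' * r`. -/
theorem product_of_left_ore_sets_satisfies_left_ore_condition
    {R : Type*} [Ring R] {S T : Set R}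
    (hS : IsLeftOreSet S) (hT : IsLeftOreSet T) :
    ∀ u ∈ {x : R | ∃ s ∈ S, ∃ t ∈ T, x = s * t}, ∀ r : R,
      ∃ u' ∈ {x : R | ∃ s ∈ S, ∃ t ∈ T, x = s * t}, ∃ r' : R, r' * u = u' * r := by
  rintro u ⟨s, hs, t, ht, rfl⟩ r
  obtain ⟨t1, ht1, r1, h1⟩ := hT.ore t ht r
  obtain ⟨s1, hs1, r2, h2⟩ := hS.ore s hs r1
  refine ⟨s1 * t1, ⟨s1, hs1, t1, ht1, rfl⟩, r2, ?_⟩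
  rw [← mul_assoc, h2, mul_assoc, h1, mul_assoc]
end

section
/- If S and T are left Ore sets in a unital ring R, then the multiplicative submonoid S∨T of R generated by S ∪ T is again a left Ore set in R (it satisfies both the left Ore condition and left reversibility). -/
/-- If `S` and `T` are left Ore sets in a unital ring `R`, then the multiplicative
submonoid `S ∨ T` of `R` generated by `S ∪ T` (assumed not to contain `0`) is again a
left Ore set in `R`: it satisfies both the left Ore condition and left reversibility. -/
theorem join_of_left_ore_sets_is_left_ore
    {R : Type*} [Ring R] {S T : Set R}
    (hS : IsLeftOreSet S) (hT : IsLeftOreSet T)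
    (h0 : (0 : R) ∉ (Submonoid.closure (S ∪ T) : Set R)) :
    IsLeftOreSet ((Submonoid.closure (S ∪ T) : Set R)) := by
  refine ⟨one_mem _, fun s t hs ht => mul_mem hs ht, h0, ?_, ?_⟩
  · intro s hs
    induction hs using Submonoid.closure_induction with
    | mem x hx =>
      intro r
      rcases hx with hx | hx
      · obtain ⟨s', h, r', e⟩ := hS.ore x hx r
        exact ⟨s', Submonoid.subset_closure (Or.inl h), r', e⟩
      · obtain ⟨s', h, r', e⟩ := hT.ore x hx r
        exact ⟨s', Submonoid.subset_closure (Or.inr h), r', e⟩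
    | one => exact fun r => ⟨1, one_mem _, r, by simp⟩
    | mul a b _ _ iha ihb =>
      intro r
      obtain ⟨s1, h1, r1, e1⟩ := ihb r
      obtain ⟨s2, h2, r2, e2⟩ := iha r1
      exact ⟨s2 * s1, mul_mem h2 h1, r2, by rw [← mul_assoc, e2, mul_assoc, e1, mul_assoc]⟩
  · intro n s hs
    induction hs using Submonoid.closure_induction generalizing n with
    | mem x hx =>
      intro e
      rcases hx with hx | hx
      · obtain ⟨s', h, e⟩ := hS.reversible n x hx e
        exact ⟨s', Submonoid.subset_closure (Or.inl h), e⟩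
      · obtain ⟨s', h, e⟩ := hT.reversible n x hx e
        exact ⟨s', Submonoid.subset_closure (Or.inr h), e⟩
    | one => exact fun e => ⟨1, one_mem _, by simpa using e⟩
    | mul a b _ _ iha ihb =>
      intro e
      obtain ⟨s1, h1, e1⟩ := ihb (n * a) (by rw [mul_assoc, e])
      obtain ⟨s2, h2, e2⟩ := iha (s1 * n) (by rw [mul_assoc, e1])
      exact ⟨s2 * s1, mul_mem h2 h1, by rw [mul_assoc, e2]⟩
end

section
/- Practical criterion of compatibility: Let k be a field, B a bialgebra over k, (E,ρ) a right B-comodule algebra, and T a left Ore set in E. Then T is ρ-compatible if and only if for every t ∈ T the element (i_T ⊗ id_B)(ρ(t)) is invertible in the k-algebra (T⁻¹E) ⊗ B. -/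
open scoped TensorProduct

/-- `i : R →+* Q` realizes `Q` as the left Ore localization `S⁻¹R`. -/
structure IsLeftOreRingLocalization {R : Type*} [Ring R] (S : Set R)
    {Q : Type*} [Ring Q] (i : R →+* Q) : Prop where
  isUnit : ∀ s ∈ S, IsUnit (i s)
  surj : ∀ x : Q, ∃ s ∈ S, ∃ r : R, i s * x = i r
  ker : ∀ r : R, i r = 0 ↔ ∃ s ∈ S, s * r = 0

/-- `(E, ρ)` is a right `B`-comodule algebra: `ρ` is a `k`-algebra map which is
coassociative and counital. -/
structure IsComoduleAlgebra (k : Type*) [CommRing k]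
    (B : Type*) [Ring B] [Bialgebra k B]
    {E : Type*} [Ring E] [Algebra k E]
    (ρ : E →ₐ[k] E ⊗[k] B) : Prop where
  coassoc : ∀ e : E,
      TensorProduct.assoc k E B B (TensorProduct.map ρ.toLinearMap LinearMap.id (ρ e))
        = TensorProduct.map LinearMap.id (Coalgebra.comul (R := k) (A := B)) (ρ e)
  counit : ∀ e : E,
      TensorProduct.rid k E
        (TensorProduct.map LinearMap.id (Coalgebra.counit (R := k) (A := B)) (ρ e)) = e

theorem ore_lift_aux {k : Type*} [Field k] {E Q A : Type*} [Ring E] [Algebra k E]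
    [Ring Q] [Algebra k Q] [Ring A] [Algebra k A] {T : Set E} (hT : IsLeftOreSet T)
    (i : E →ₐ[k] Q) (hloc : IsLeftOreRingLocalization T i.toRingHom)
    (f : E →ₐ[k] A) (hf : ∀ t ∈ T, IsUnit (f t)) :
    ∃ g : Q →ₐ[k] A, ∀ e, g (i e) = f e := by
  have hsurj : ∀ x : Q, ∃ s ∈ T, ∃ r : E, i s * x = i r := hloc.surj
  have hker : ∀ r : E, i r = 0 → ∃ s ∈ T, s * r = 0 := fun r h => (hloc.ker r).1 h
  have key : ∀ a b : E, i a = i b → f a = f b := by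
    intro a b h
    obtain ⟨s, hs, h0⟩ := hker (a - b) (by rw [map_sub, h, sub_self])
    have h1 : f s * f (a - b) = f s * 0 := by rw [← map_mul, h0, map_zero, mul_zero]
    have h2 := (hf s hs).mul_left_cancel h1
    rwa [map_sub, sub_eq_zero] at h2
  let R : Q → A → Prop := fun x y => ∃ s ∈ T, ∃ r : E, i s * x = i r ∧ f s * y = f r
  have tot : ∀ x, ∃ y, R x y := by
    intro x
    obtain ⟨s, hs, r, h⟩ := hsurj x
    obtain ⟨u, hu⟩ := hf s hs
    exact ⟨↑u⁻¹ * f r, s, hs, r, h, by rw [← hu, Units.mul_inv_cancel_left]⟩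
  have common : ∀ x₁ y₁ x₂ y₂, R x₁ y₁ → R x₂ y₂ → ∃ s ∈ T, ∃ r₁ r₂ : E,
      i s * x₁ = i r₁ ∧ f s * y₁ = f r₁ ∧ i s * x₂ = i r₂ ∧ f s * y₂ = f r₂ := by
    rintro x₁ y₁ x₂ y₂ ⟨s₁, hs₁, r₁, a₁, b₁⟩ ⟨s₂, hs₂, r₂, a₂, b₂⟩
    obtain ⟨u, hu, v, huv⟩ := hT.ore s₂ hs₂ s₁
    refine ⟨u * s₁, hT.mul_mem hu hs₁, u * r₁, v * r₂, ?_, ?_, ?_, ?_⟩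
    · rw [map_mul, mul_assoc, a₁, map_mul]
    · rw [map_mul, mul_assoc, b₁, map_mul]
    · rw [← huv, map_mul, mul_assoc, a₂, map_mul]
    · rw [← huv, map_mul, mul_assoc, b₂, map_mul]
  have uniq : ∀ x y y', R x y → R x y' → y = y' := by
    intro x y y' h h'
    obtain ⟨s, hs, r₁, r₂, a₁, b₁, a₂, b₂⟩ := common _ _ _ _ h h'
    exact (hf s hs).mul_left_cancel (by rw [b₁, b₂, key r₁ r₂ (a₁.symm.trans a₂)])
  have hadd : ∀ x₁ y₁ x₂ y₂, R x₁ y₁ → R x₂ y₂ → R (x₁ + x₂) (y₁ + y₂) := by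
    intro x₁ y₁ x₂ y₂ h₁ h₂
    obtain ⟨s, hs, r₁, r₂, a₁, b₁, a₂, b₂⟩ := common _ _ _ _ h₁ h₂
    exact ⟨s, hs, r₁ + r₂, by rw [mul_add, a₁, a₂, map_add], by rw [mul_add, b₁, b₂, map_add]⟩
  have hmul : ∀ x₁ y₁ x₂ y₂, R x₁ y₁ → R x₂ y₂ → R (x₁ * x₂) (y₁ * y₂) := by
    rintro x₁ y₁ x₂ y₂ ⟨s₁, hs₁, r₁, a₁, b₁⟩ ⟨s₂, hs₂, r₂, a₂, b₂⟩
    obtain ⟨u, hu, v, huv⟩ := hT.ore s₂ hs₂ r₁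
    refine ⟨u * s₁, hT.mul_mem hu hs₁, v * r₂, ?_, ?_⟩
    · rw [map_mul, mul_assoc, ← mul_assoc (i s₁), a₁, ← mul_assoc, ← map_mul, ← huv, map_mul,
        mul_assoc, a₂, map_mul]
    · rw [map_mul, mul_assoc, ← mul_assoc (f s₁), b₁, ← mul_assoc, ← map_mul, ← huv, map_mul,
        mul_assoc, b₂, map_mul]
  have hi : ∀ e, R (i e) (f e) := fun e =>
    ⟨1, hT.one_mem, e, by rw [map_one, one_mul], by rw [map_one, one_mul]⟩
  choose g hg using tot
  have gi : ∀ e, g (i e) = f e := fun e => uniq _ _ _ (hg _) (hi e)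
  refine ⟨{ toFun := g, map_one' := ?_, map_mul' := ?_, map_zero' := ?_, map_add' := ?_,
            commutes' := ?_ }, gi⟩
  · rw [← map_one i, gi, map_one]
  · intro x y
    exact uniq _ _ _ (hg _) (hmul _ _ _ _ (hg x) (hg y))
  · change g 0 = 0
    rw [← map_zero i, gi, map_zero]
  · intro x y
    exact uniq _ _ _ (hg _) (hadd _ _ _ _ (hg x) (hg y))
  · intro c
    change g (algebraMap k Q c) = _
    rw [← i.commutes, gi, f.commutes]

theorem ore_hom_ext_aux {k : Type*} [Field k] {E Q A : Type*} [Ring E] [Algebra k E]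
    [Ring Q] [Algebra k Q] [Ring A] [Algebra k A] {T : Set E}
    (i : E →ₐ[k] Q) (hloc : IsLeftOreRingLocalization T i.toRingHom)
    (g h : Q →ₐ[k] A) (hgh : ∀ e, g (i e) = h (i e)) : g = h := by
  ext x
  obtain ⟨s, hs, r, hx⟩ := hloc.surj x
  have hx' : i s * x = i r := hx
  have hu : IsUnit (i s) := hloc.isUnit s hs
  have hu' : IsUnit (g (i s)) := hu.map g
  refine hu'.mul_left_cancel ?_
  rw [← map_mul, hx', hgh s, ← map_mul, hx', hgh]

/-- **Practical criterion of compatibility.** Let `B` be a bialgebra over a field `k`,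
`(E, ρ)` a right `B`-comodule algebra, `T` a left Ore set in `E`, and
`i_T : E → T⁻¹E` its Ore localization. Then `T` is `ρ`-compatible — i.e. there exists a
(necessarily unique) `k`-algebra map `ρ_T : T⁻¹E → T⁻¹E ⊗ B` making `T⁻¹E` a right
`B`-comodule algebra with `ρ_T ∘ i_T = (i_T ⊗ id) ∘ ρ` — if and only if for every
`t ∈ T` the element `(i_T ⊗ id)(ρ t)` is invertible in `T⁻¹E ⊗ B`. -/
theorem compatibility_criterion
    {k : Type*} [Field k] {B : Type*} [Ring B] [Bialgebra k B]
    {E : Type*} [Ring E] [Algebra k E]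
    (ρ : E →ₐ[k] E ⊗[k] B) (hρ : IsComoduleAlgebra k B ρ)
    {T : Set E} (hT : IsLeftOreSet T)
    {Q : Type*} [Ring Q] [Algebra k Q]
    (iT : E →ₐ[k] Q) (hloc : IsLeftOreRingLocalization T iT.toRingHom) :
    (∃ ρT : Q →ₐ[k] Q ⊗[k] B, IsComoduleAlgebra k B ρT ∧
        ∀ e : E, ρT (iT e) = Algebra.TensorProduct.map iT (AlgHom.id k B) (ρ e))
      ↔ ∀ t ∈ T, IsUnit (Algebra.TensorProduct.map iT (AlgHom.id k B) (ρ t)) := by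
  constructor
  · rintro ⟨ρT, -, h⟩ t ht
    rw [← h]
    have hu : IsUnit (iT t) := hloc.isUnit t ht
    exact hu.map ρT
  · intro hunit
    obtain ⟨ρT, hρT⟩ := ore_lift_aux hT iT hloc
      ((Algebra.TensorProduct.map iT (AlgHom.id k B)).comp ρ) hunit
    have hρT' : ∀ e, ρT (iT e) = Algebra.TensorProduct.map iT (AlgHom.id k B) (ρ e) := hρT
    refine ⟨ρT, ⟨?_, ?_⟩, hρT'⟩
    · have key := ore_hom_ext_aux iT hloc
        (((Algebra.TensorProduct.assoc k k k Q B B).toAlgHom.comp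
          (Algebra.TensorProduct.map ρT (AlgHom.id k B))).comp ρT)
        ((Algebra.TensorProduct.map (AlgHom.id k Q) (Bialgebra.comulAlgHom k B)).comp ρT) ?_
      · exact fun e => DFunLike.congr_fun key e
      · intro e
        have h1 : ∀ z : E ⊗[k] B, (Algebra.TensorProduct.assoc k k k Q B B)
            (Algebra.TensorProduct.map ρT (AlgHom.id k B)
              (Algebra.TensorProduct.map iT (AlgHom.id k B) z)) =
            TensorProduct.map iT.toLinearMap LinearMap.id
              (TensorProduct.assoc k E B B
                (TensorProduct.map ρ.toLinearMap LinearMap.id z)) := by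
          intro z
          induction z with
          | zero => simp only [map_zero]
          | add x y hx hy => simp only [map_add, hx, hy]
          | tmul a b =>
            simp only [Algebra.TensorProduct.map_tmul, hρT', TensorProduct.map_tmul,
              AlgHom.id_apply, LinearMap.id_apply, AlgHom.toLinearMap_apply]
            generalize ρ a = w
            induction w with
            | zero => simp only [map_zero, TensorProduct.zero_tmul]
            | add x y hx hy => simp only [map_add, TensorProduct.add_tmul, hx, hy]
            | tmul c d => simp
        have h2 : ∀ z : E ⊗[k] B,
            Algebra.TensorProduct.map (AlgHom.id k Q) (Bialgebra.comulAlgHom k B)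
              (Algebra.TensorProduct.map iT (AlgHom.id k B) z) =
            TensorProduct.map iT.toLinearMap LinearMap.id
              (TensorProduct.map LinearMap.id (Coalgebra.comul (R := k) (A := B)) z) := by
          intro z
          induction z with
          | zero => simp only [map_zero]
          | add x y hx hy => simp only [map_add, hx, hy]
          | tmul a b => simp
        have h3 := h1 (ρ e)
        rw [hρ.coassoc, ← h2, ← hρT'] at h3
        exact h3
    · have key := ore_hom_ext_aux iT hloc
        (((Algebra.TensorProduct.rid k k Q).toAlgHom.comp
          (Algebra.TensorProduct.map (AlgHom.id k Q) (Bialgebra.counitAlgHom k B))).comp ρT)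
        (AlgHom.id k Q) ?_
      · exact fun e => DFunLike.congr_fun key e
      · intro e
        have h1 : ∀ z : E ⊗[k] B, (Algebra.TensorProduct.rid k k Q)
            (Algebra.TensorProduct.map (AlgHom.id k Q) (Bialgebra.counitAlgHom k B)
              (Algebra.TensorProduct.map iT (AlgHom.id k B) z)) =
            iT (TensorProduct.rid k E
              (TensorProduct.map LinearMap.id (Coalgebra.counit (R := k) (A := B)) z)) := by
          intro z
          induction z with
          | zero => simp only [map_zero]
          | add x y hx hy => simp only [map_add, hx, hy]
          | tmul a b => simp
        have h3 := h1 (ρ e)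
        rw [hρ.counit, ← hρT'] at h3
        exact h3
end

section
/- Nested localizations, part (i): Let k be a field, B a bialgebra over k, (E,ρ) a right B-comodule algebra, and S ⊆ T left Ore sets in E which are both ρ-compatible, with localized coactions ρ_S and ρ_T. Let i^S_T : S⁻¹E → T⁻¹E be the canonical ring homomorphism determined by i^S_T ∘ i_S = i_T. Then ρ_T ∘ i^S_T = (i^S_T ⊗ id_B) ∘ ρ_S, i.e. the natural map between the localizations intertwines the localized coactions. -/
open scoped TensorProduct

/-- **Nested localizations, part (i).** Let `S ⊆ T` be `ρ`-compatible left Ore sets in a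
right `B`-comodule algebra `(E, ρ)`, with localized coactions `ρS` and `ρT`, and let
`j : S⁻¹E → T⁻¹E` be the canonical ring map determined by `j ∘ i_S = i_T`.  Then
`ρT ∘ j = (j ⊗ id_B) ∘ ρS`, i.e. `j` intertwines the localized coactions. -/
theorem nested_localizations_intertwine
    {k : Type*} [Field k] {B : Type*} [Ring B] [Bialgebra k B]
    {E : Type*} [Ring E] [Algebra k E]
    (ρ : E →ₐ[k] E ⊗[k] B) (hρ : IsComoduleAlgebra k B ρ)
    {S T : Set E} (hS : IsLeftOreSet S) (hT : IsLeftOreSet T) (hST : S ⊆ T)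
    {QS : Type*} [Ring QS] [Algebra k QS]
    (iS : E →ₐ[k] QS) (hlocS : IsLeftOreRingLocalization S iS.toRingHom)
    {QT : Type*} [Ring QT] [Algebra k QT]
    (iT : E →ₐ[k] QT) (hlocT : IsLeftOreRingLocalization T iT.toRingHom)
    (ρS : QS →ₐ[k] QS ⊗[k] B) (hρS : IsComoduleAlgebra k B ρS)
    (hcompatS : ∀ e : E, ρS (iS e) = Algebra.TensorProduct.map iS (AlgHom.id k B) (ρ e))
    (ρT : QT →ₐ[k] QT ⊗[k] B) (hρT : IsComoduleAlgebra k B ρT)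
    (hcompatT : ∀ e : E, ρT (iT e) = Algebra.TensorProduct.map iT (AlgHom.id k B) (ρ e))
    (j : QS →ₐ[k] QT) (hj : ∀ e : E, j (iS e) = iT e) :
    ∀ x : QS, ρT (j x) = Algebra.TensorProduct.map j (AlgHom.id k B) (ρS x) := by
  have key : ∀ e : E, ρT (j (iS e)) =
      Algebra.TensorProduct.map j (AlgHom.id k B) (ρS (iS e)) := by
    intro e
    have hjc : j.comp iS = iT := AlgHom.ext hj
    have hc : (Algebra.TensorProduct.map j (AlgHom.id k B)).comp
        (Algebra.TensorProduct.map iS (AlgHom.id k B)) =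
        Algebra.TensorProduct.map iT (AlgHom.id k B) := by
      rw [← Algebra.TensorProduct.map_comp, hjc, AlgHom.comp_id]
    rw [hj, hcompatT, hcompatS, ← hc, AlgHom.comp_apply]
  intro x
  obtain ⟨s, hs, r, hr⟩ := hlocS.surj x
  have hr' : iS s * x = iS r := hr
  have hu : IsUnit (iS s) := hlocS.isUnit s hs
  have hu' : IsUnit (ρT (j (iS s))) := (hu.map j).map ρT
  apply hu'.mul_left_cancel
  rw [← map_mul, ← map_mul, hr', key r, key s, ← map_mul, ← map_mul, hr']
end

section
/- Nested localizations, part (ii): Let k be a field, B a bialgebra over k, (E,ρ) a right B-comodule algebra, and S ⊆ T left Ore sets in E which are both ρ-compatible, with localized coactions ρ_S and ρ_T. Then the canonical map i^S_T : S⁻¹E → T⁻¹E (determined by i^S_T ∘ i_S = i_T) maps the subalgebra of S-localized coinvariants into the subalgebra of T-localized coinvariants: i^S_T((S⁻¹E)^{coB}) ⊆ (T⁻¹E)^{coB}. -/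
open scoped TensorProduct

/-- The coinvariants `A^{co B}` of a right `B`-comodule algebra. -/
def coinvariants (k : Type*) [CommRing k] {B : Type*} [Ring B] [Bialgebra k B]
    {A : Type*} [Ring A] [Algebra k A] (ρ : A →ₐ[k] A ⊗[k] B) : Set A :=
  {a | ρ a = a ⊗ₜ[k] (1 : B)}

/-- **Nested localizations, part (ii).** Let `S ⊆ T` be `ρ`-compatible left Ore sets in a
right `B`-comodule algebra `(E, ρ)`, with localized coactions `ρS` and `ρT`, and let
`j : S⁻¹E → T⁻¹E` be the canonical map determined by `j ∘ i_S = i_T`.  Then `j` maps the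
subalgebra of `S`-localized coinvariants into the subalgebra of `T`-localized
coinvariants: `j((S⁻¹E)^{co B}) ⊆ (T⁻¹E)^{co B}`. -/
theorem nested_localizations_coinvariants
    {k : Type*} [Field k] {B : Type*} [Ring B] [Bialgebra k B]
    {E : Type*} [Ring E] [Algebra k E]
    (ρ : E →ₐ[k] E ⊗[k] B) (hρ : IsComoduleAlgebra k B ρ)
    {S T : Set E} (hS : IsLeftOreSet S) (hT : IsLeftOreSet T) (hST : S ⊆ T)
    {QS : Type*} [Ring QS] [Algebra k QS]
    (iS : E →ₐ[k] QS) (hlocS : IsLeftOreRingLocalization S iS.toRingHom)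
    {QT : Type*} [Ring QT] [Algebra k QT]
    (iT : E →ₐ[k] QT) (hlocT : IsLeftOreRingLocalization T iT.toRingHom)
    (ρS : QS →ₐ[k] QS ⊗[k] B) (hρS : IsComoduleAlgebra k B ρS)
    (hcompatS : ∀ e : E, ρS (iS e) = Algebra.TensorProduct.map iS (AlgHom.id k B) (ρ e))
    (ρT : QT →ₐ[k] QT ⊗[k] B) (hρT : IsComoduleAlgebra k B ρT)
    (hcompatT : ∀ e : E, ρT (iT e) = Algebra.TensorProduct.map iT (AlgHom.id k B) (ρ e))
    (j : QS →ₐ[k] QT) (hj : ∀ e : E, j (iS e) = iT e) :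
    j '' (coinvariants k ρS) ⊆ coinvariants k ρT := by
  have key : ∀ e : E, ρT (j (iS e)) =
      Algebra.TensorProduct.map j (AlgHom.id k B) (ρS (iS e)) := by
    intro e
    rw [hj, hcompatT, hcompatS]
    have h : Algebra.TensorProduct.map iT (AlgHom.id k B) =
        (Algebra.TensorProduct.map j (AlgHom.id k B)).comp
          (Algebra.TensorProduct.map iS (AlgHom.id k B)) := by
      apply Algebra.TensorProduct.ext'
      intro a b
      simp [hj]
    rw [h]
    rfl
  rintro _ ⟨x, hx, rfl⟩
  have hx' : ρS x = x ⊗ₜ[k] (1 : B) := hx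
  obtain ⟨s, hs, r, hr⟩ := hlocS.surj x
  have hr' : iS s * x = iS r := hr
  have hu : IsUnit (iS s) := hlocS.isUnit s hs
  have hu' : IsUnit (ρT (j (iS s))) := (hu.map j).map ρT
  have h2 : ρT (j x) = Algebra.TensorProduct.map j (AlgHom.id k B) (ρS x) := by
    apply hu'.mul_left_cancel
    rw [← map_mul, ← map_mul, hr', key s, ← map_mul, ← map_mul, hr', key r]
  change ρT (j x) = j x ⊗ₜ[k] (1 : B)
  rw [h2, hx']
  simp
end

section
/- Localization of relative Hopf modules: Let k be a field, B a bialgebra over k, (E,ρ) a right B-comodule algebra, and S a ρ-compatible left Ore set in E with localized coaction ρ_S on S⁻¹E (write ρ_S(x) = Σ x₍₀₎ ⊗ x₍₁₎). Let M be a relative (E,B)-Hopf module: a left E-module which is also a right B-comodule via ρ_M : M → M ⊗ B (write ρ_M(m) = Σ m₍₀₎ ⊗ m₍₁₎) such that ρ_M(em) = Σ e₍₀₎m₍₀₎ ⊗ e₍₁₎m₍₁₎ for all e ∈ E, m ∈ M. Then on S⁻¹M = S⁻¹E ⊗_E M there exists a unique k-linear map ρ_{S⁻¹M} : S⁻¹M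 → (S⁻¹M) ⊗ B satisfying ρ_{S⁻¹M}(x ⊗_E m) = Σ (x₍₀₎ ⊗_E m₍₀₎) ⊗ x₍₁₎m₍₁₎ for all x ∈ S⁻¹E and m ∈ M, and ρ_{S⁻¹M} makes S⁻¹M a relative (S⁻¹E,B)-Hopf module (it is coassociative, counital, and satisfies the same compatibility with the S⁻¹E-action). -/
open scoped TensorProduct

/-- `(M, ρM)` is a right `B`-comodule. -/
structure IsRightComodule (k : Type*) [CommRing k]
    (B : Type*) [Ring B] [Bialgebra k B]
    {M : Type*} [AddCommGroup M] [Module k M]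
    (ρM : M →ₗ[k] M ⊗[k] B) : Prop where
  coassoc : ∀ m : M,
      TensorProduct.assoc k M B B (TensorProduct.map ρM LinearMap.id (ρM m))
        = TensorProduct.map LinearMap.id (Coalgebra.comul (R := k) (A := B)) (ρM m)
  counit : ∀ m : M,
      TensorProduct.rid k M
        (TensorProduct.map LinearMap.id (Coalgebra.counit (R := k) (A := B)) (ρM m)) = m

/-- The `E`-action on `M` as a `k`-linear map `E ⊗ M → M`. -/
noncomputable def actionMap (k : Type*) [CommRing k] (E : Type*) [Ring E] [Algebra k E]
    (M : Type*) [AddCommGroup M] [Module k M] [Module E M] [IsScalarTower k E M] :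
    E ⊗[k] M →ₗ[k] M :=
  TensorProduct.lift
    { toFun := fun e =>
        { toFun := fun m => e • m
          map_add' := fun m m' => smul_add e m m'
          map_smul' := fun c m => by
            simp only [RingHom.id_apply]
            rw [← algebraMap_smul E c m, ← mul_smul, ← Algebra.commutes, mul_smul,
              algebraMap_smul] }
      map_add' := fun e e' => by ext m; exact add_smul e e' m
      map_smul' := fun c e => by ext m; exact smul_assoc c e m }

namespace HopfLoc

section act
variable (k : Type*) [CommRing k] (A : Type*) [Ring A] [Algebra k A]
  (Q : Type*) [Ring Q] [Algebra k Q]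
  (N : Type*) [AddCommGroup N] [Module k N] [Module Q N] [IsScalarTower k Q N]

noncomputable def act : (Q ⊗[k] A) →ₗ[k] (N ⊗[k] A) →ₗ[k] (N ⊗[k] A) :=
  TensorProduct.curry ((TensorProduct.map (actionMap k Q N) (LinearMap.mul' k A)) ∘ₗ
    (TensorProduct.tensorTensorTensorComm k Q A N A).toLinearMap)

variable {k A Q N}

theorem act_apply (u : Q ⊗[k] A) (v : N ⊗[k] A) : act k A Q N u v =
    TensorProduct.map (actionMap k Q N) (LinearMap.mul' k A)
      (TensorProduct.tensorTensorTensorComm k Q A N A (u ⊗ₜ[k] v)) := rfl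

theorem act_tmul (q : Q) (a : A) (n : N) (b : A) :
    act k A Q N (q ⊗ₜ a) (n ⊗ₜ b) = (q • n) ⊗ₜ (a * b) := rfl

theorem act_one (v : N ⊗[k] A) : act k A Q N 1 v = v := by
  induction v with
  | zero => simp
  | add x y hx hy => rw [map_add, hx, hy]
  | tmul n b => rw [Algebra.TensorProduct.one_def, act_tmul, one_smul, one_mul]

theorem act_mul (u w : Q ⊗[k] A) (v : N ⊗[k] A) :
    act k A Q N (u * w) v = act k A Q N u (act k A Q N w v) := by
  induction v with
  | zero => simp
  | add x y hx hy => simp only [map_add, hx, hy]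
  | tmul n b =>
    induction w with
    | zero => simp
    | add x y hx hy => simp only [mul_add, map_add, LinearMap.add_apply, hx, hy]
    | tmul q a =>
      induction u with
      | zero => simp
      | add x y hx hy => simp only [add_mul, map_add, LinearMap.add_apply, hx, hy]
      | tmul p c => 
        rw [Algebra.TensorProduct.tmul_mul_tmul, act_tmul, act_tmul, act_tmul, mul_smul, mul_assoc]

theorem act_map {A' : Type*} [Ring A'] [Algebra k A']
    {E : Type*} [Ring E] [Algebra k E]
    {M : Type*} [AddCommGroup M] [Module k M] [Module E M] [IsScalarTower k E M]
    (i : E →ₗ[k] Q) (f : M →ₗ[k] N) (hf : ∀ e m, f (e • m) = i e • f m)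
    (φ : A →ₐ[k] A') (u : E ⊗[k] A) (v : M ⊗[k] A) :
    TensorProduct.map f φ.toLinearMap (act k A E M u v) =
      act k A' Q N (TensorProduct.map i φ.toLinearMap u) (TensorProduct.map f φ.toLinearMap v) := by
  induction v with
  | zero => simp
  | add x y hx hy => simp only [map_add, hx, hy]
  | tmul n b =>
    induction u with
    | zero => simp
    | add x y hx hy => simp only [map_add, LinearMap.add_apply, hx, hy]
    | tmul q a =>
      simp [act_tmul, hf]

theorem act_assoc (u : Q ⊗[k] A) (v : N ⊗[k] A) (b c : A) :
    TensorProduct.assoc k N A A (act k A Q N u v ⊗ₜ (b * c)) =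
      act k (A ⊗[k] A) Q N (TensorProduct.assoc k Q A A (u ⊗ₜ b))
        (TensorProduct.assoc k N A A (v ⊗ₜ c)) := by
  induction v with
  | zero => simp
  | add x y hx hy => simp only [map_add, TensorProduct.add_tmul, hx, hy]
  | tmul n d =>
    induction u with
    | zero => simp
    | add x y hx hy => simp only [map_add, LinearMap.add_apply, TensorProduct.add_tmul, hx, hy]
    | tmul q a => simp [act_tmul]

theorem act_coact (ρS : Q →ₗ[k] Q ⊗[k] A) (ρN : N →ₗ[k] N ⊗[k] A)
    (h : ∀ q n, ρN (q • n) = act k A Q N (ρS q) (ρN n)) (u : Q ⊗[k] A) (v : N ⊗[k] A) :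
    TensorProduct.assoc k N A A (TensorProduct.map ρN LinearMap.id (act k A Q N u v)) =
      act k (A ⊗[k] A) Q N (TensorProduct.assoc k Q A A (TensorProduct.map ρS LinearMap.id u))
        (TensorProduct.assoc k N A A (TensorProduct.map ρN LinearMap.id v)) := by
  induction v with
  | zero => simp
  | add x y hx hy => simp only [map_add, hx, hy]
  | tmul n d =>
    induction u with
    | zero => simp
    | add x y hx hy => simp only [map_add, LinearMap.add_apply, hx, hy]
    | tmul q a =>
      simp only [act_tmul, TensorProduct.map_tmul, h, LinearMap.id_apply, act_assoc]

theorem act_rid (u : Q ⊗[k] k) (v : N ⊗[k] k) :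
    TensorProduct.rid k N (act k k Q N u v) = TensorProduct.rid k Q u • TensorProduct.rid k N v := by
  have : SMulCommClass k Q N := IsScalarTower.to_smulCommClass
  induction v with
  | zero => simp
  | add x y hx hy => simp only [map_add, hx, hy, smul_add]
  | tmul n d =>
    induction u with
    | zero => simp
    | add x y hx hy => simp only [map_add, LinearMap.add_apply, hx, hy, add_smul]
    | tmul q a => simp [act_tmul, mul_smul, smul_comm q d n]

theorem stmt_eq {M : Type*} [AddCommGroup M] [Module k M] (f : M →ₗ[k] N)
    (u : Q ⊗[k] A) (v : M ⊗[k] A) :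
    TensorProduct.map ((actionMap k Q N) ∘ₗ TensorProduct.map LinearMap.id f)
      (LinearMap.mul' k A) (TensorProduct.tensorTensorTensorComm k Q A M A (u ⊗ₜ[k] v)) =
    act k A Q N u (TensorProduct.map f LinearMap.id v) := by
  induction v with
  | zero => simp
  | add x y hx hy => simp only [map_add, TensorProduct.tmul_add, hx, hy]
  | tmul n d =>
    induction u with
    | zero => simp
    | add x y hx hy => simp only [map_add, LinearMap.add_apply, TensorProduct.add_tmul, hx, hy]
    | tmul q a => rfl

end act

end HopfLoc

/-- **Localization of relative Hopf modules.** Let `B` be a bialgebra over a field `k`,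
`(E, ρ)` a right `B`-comodule algebra, `S` a `ρ`-compatible left Ore set in `E` with
localized coaction `ρS` on `Q = S⁻¹E`, and `M` a relative `(E, B)`-Hopf module, i.e. a
left `E`-module and right `B`-comodule `(M, ρM)` with
`ρM(e·m) = Σ e₍₀₎·m₍₀₎ ⊗ e₍₁₎·m₍₁₎`.  Let `f : M → N` realize `N` as the localized
module `S⁻¹M = S⁻¹E ⊗_E M`.  Then there is a unique `k`-linear map
`ρN : N → N ⊗ B` with `ρN(x • f m) = Σ (x₍₀₎ • f m₍₀₎) ⊗ x₍₁₎·m₍₁₎` for all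
`x ∈ S⁻¹E`, `m ∈ M`; and any such `ρN` makes `N` a relative `(S⁻¹E, B)`-Hopf module:
it is coassociative, counital, and `ρN(y • n) = Σ (y₍₀₎ • n₍₀₎) ⊗ y₍₁₎·n₍₁₎`. -/
theorem localization_of_relative_hopf_modules
    {k : Type*} [Field k] {B : Type*} [Ring B] [Bialgebra k B]
    {E : Type*} [Ring E] [Algebra k E]
    (ρ : E →ₐ[k] E ⊗[k] B) (hρ : IsComoduleAlgebra k B ρ)
    {S : Set E} (hS : IsLeftOreSet S)
    {Q : Type*} [Ring Q] [Algebra k Q]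
    (iS : E →ₐ[k] Q) (hloc : IsLeftOreRingLocalization S iS.toRingHom)
    (ρS : Q →ₐ[k] Q ⊗[k] B) (hρS : IsComoduleAlgebra k B ρS)
    (hcompat : ∀ e : E, ρS (iS e) = Algebra.TensorProduct.map iS (AlgHom.id k B) (ρ e))
    {M : Type*} [AddCommGroup M] [Module k M] [Module E M] [IsScalarTower k E M]
    (ρM : M →ₗ[k] M ⊗[k] B) (hM : IsRightComodule k B ρM)
    (hHopf : ∀ (e : E) (m : M),
      ρM (e • m) =
        TensorProduct.map (actionMap k E M) (LinearMap.mul' k B)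
          (TensorProduct.tensorTensorTensorComm k E B M B ((ρ e) ⊗ₜ[k] (ρM m))))
    {N : Type*} [AddCommGroup N] [Module k N] [Module Q N] [IsScalarTower k Q N]
    (f : M →ₗ[k] N)
    (hf_semilinear : ∀ (e : E) (m : M), f (e • m) = iS e • f m)
    (hf_surj : ∀ n : N, ∃ s ∈ S, ∃ m : M, iS s • n = f m)
    (hf_ker : ∀ m : M, f m = 0 ↔ ∃ s ∈ S, s • m = 0) :
    (∃! ρN : N →ₗ[k] N ⊗[k] B,
      ∀ (x : Q) (m : M),
        ρN (x • f m) =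
          TensorProduct.map ((actionMap k Q N) ∘ₗ TensorProduct.map LinearMap.id f)
            (LinearMap.mul' k B)
            (TensorProduct.tensorTensorTensorComm k Q B M B ((ρS x) ⊗ₜ[k] (ρM m)))) ∧
    ∀ ρN : N →ₗ[k] N ⊗[k] B,
      (∀ (x : Q) (m : M),
        ρN (x • f m) =
          TensorProduct.map ((actionMap k Q N) ∘ₗ TensorProduct.map LinearMap.id f)
            (LinearMap.mul' k B)
            (TensorProduct.tensorTensorTensorComm k Q B M B ((ρS x) ⊗ₜ[k] (ρM m)))) →
      IsRightComodule k B ρN ∧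
      ∀ (y : Q) (n : N),
        ρN (y • n) =
          TensorProduct.map (actionMap k Q N) (LinearMap.mul' k B)
            (TensorProduct.tensorTensorTensorComm k Q B N B ((ρS y) ⊗ₜ[k] (ρN n))) := by
  have : SMulCommClass k Q N := IsScalarTower.to_smulCommClass
  simp only [HopfLoc.stmt_eq]
  simp only [← HopfLoc.act_apply] at hHopf ⊢
  -- the map `g`
  let g : M →ₗ[k] N ⊗[k] B := TensorProduct.map f LinearMap.id ∘ₗ ρM
  have hgdef : ∀ m, TensorProduct.map f LinearMap.id (ρM m) = g m := fun _ => rfl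
  let T : Q → (N ⊗[k] B) →ₗ[k] (N ⊗[k] B) := fun x => HopfLoc.act k B Q N (ρS x)
  have hT : ∀ x, HopfLoc.act k B Q N (ρS x) = T x := fun _ => rfl
  have hTmul : ∀ x y v, T (x * y) v = T x (T y v) := fun x y v => by
    simp only [T, map_mul, HopfLoc.act_mul]
  have hTone : ∀ v, T 1 v = v := fun v => by
    simp only [T, map_one, HopfLoc.act_one]
  have hg : ∀ (e : E) (m : M), g (e • m) = T (iS e) (g m) := by
    intro e m
    simp only [g, T, LinearMap.comp_apply, hHopf, hcompat]
    exact HopfLoc.act_map iS.toLinearMap f hf_semilinear (AlgHom.id k B) (ρ e) (ρM m)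
  have hunit : ∀ s ∈ S, ∃ y : Q, y * iS s = 1 ∧ iS s * y = 1 := by
    intro s hs
    obtain ⟨w, hw⟩ := hloc.isUnit s hs
    have hw' : (w : Q) = iS s := hw
    exact ⟨(w⁻¹ : Qˣ), by rw [← hw']; simp, by rw [← hw']; simp⟩
  have hcancel : ∀ s ∈ S, ∀ v w, T (iS s) v = T (iS s) w → v = w := by
    intro s hs v w h
    obtain ⟨y, hy, -⟩ := hunit s hs
    rw [← hTone v, ← hTone w, ← hy, hTmul, hTmul, h]
  have hgen : ∀ n : N, ∃ (x : Q) (m : M), n = x • f m := by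
    intro n
    obtain ⟨s, hs, m, hm⟩ := hf_surj n
    obtain ⟨y, hy, -⟩ := hunit s hs
    exact ⟨y, m, by rw [← hm, ← mul_smul, hy, one_smul]⟩
  have hex : ∀ n : N, ∃ v : N ⊗[k] B, ∀ (e : E) (m : M), iS e • n = f m → T (iS e) v = g m := by
    intro n
    obtain ⟨s, hs, m, hm⟩ := hf_surj n
    obtain ⟨y, -, hy⟩ := hunit s hs
    refine ⟨T y (g m), fun e m' hm' => ?_⟩
    obtain ⟨s', hs', r', hr⟩ := hS.ore s hs e
    have h0 : f (s' • m' - r' • m) = 0 := by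
      rw [map_sub, hf_semilinear, hf_semilinear, ← hm, ← hm', ← mul_smul, ← mul_smul,
        ← map_mul, ← map_mul, hr, sub_self]
    obtain ⟨t, ht, h1⟩ := (hf_ker _).1 h0
    rw [smul_sub, sub_eq_zero] at h1
    apply hcancel s' hs'
    apply hcancel t ht
    rw [← hg, ← hg, h1, hg, hg, ← hTmul (iS s'), ← map_mul, ← hr, map_mul, hTmul,
      ← hTmul _ y, hy, hTone]
  choose F hF using hex
  have hFu : ∀ n s, s ∈ S → ∀ m, iS s • n = f m → ∀ v, T (iS s) v = g m → F n = v := by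
    intro n s hs m hm v hv
    exact hcancel s hs _ _ ((hF n s m hm).trans hv.symm)
  let ρ0 : N →ₗ[k] N ⊗[k] B :=
    { toFun := F
      map_add' := by
        intro n n'
        obtain ⟨s, hs, m, hm⟩ := hf_surj n
        obtain ⟨t, ht, m', hm'⟩ := hf_surj n'
        obtain ⟨s', hs', r', hr⟩ := hS.ore s hs t
        have e1 : iS (s' * t) • n = f (r' • m) := by
          rw [← hr, map_mul, mul_smul, hm, hf_semilinear]
        have e2 : iS (s' * t) • n' = f (s' • m') := by
          rw [map_mul, mul_smul, hm', hf_semilinear]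
        refine hFu _ (s' * t) (hS.mul_mem hs' ht) (r' • m + s' • m') ?_ _ ?_
        · rw [smul_add, e1, e2, map_add]
        · rw [map_add, map_add, hF n _ _ e1, hF n' _ _ e2]
      map_smul' := by
        intro c n
        obtain ⟨s, hs, m, hm⟩ := hf_surj n
        refine hFu _ s hs (c • m) ?_ _ ?_
        · rw [map_smul, ← hm, smul_comm]
        · rw [RingHom.id_apply, map_smul, map_smul, hF n _ _ hm] }
  have hρ0 : ∀ (x : Q) (m : M), ρ0 (x • f m) = T x (g m) := by
    intro x m
    obtain ⟨s, hs, r, hr⟩ := hloc.surj x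
    have hr' : iS s * x = iS r := hr
    refine hFu _ s hs (r • m) ?_ _ ?_
    · rw [← mul_smul, hr', hf_semilinear]
    · rw [← hTmul, hr', hg]
  refine ⟨⟨ρ0, hρ0, ?_⟩, ?_⟩
  · intro ρ1 h1
    ext n
    obtain ⟨x, m, rfl⟩ := hgen n
    rw [hρ0]
    exact h1 x m
  intro ρN hN
  have hN' : ∀ (x : Q) (m : M), ρN (x • f m) = T x (g m) := hN
  have hcomp : ∀ (y : Q) (n : N), ρN (y • n) = HopfLoc.act k B Q N (ρS y) (ρN n) := by
    intro y n
    obtain ⟨x, m, rfl⟩ := hgen n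
    rw [← mul_smul, hN', hN', hTmul]
  have hNf : ∀ m, ρN (f m) = g m := fun m => by
    rw [← one_smul Q (f m), hN', hTone]
  have hΔ : (Coalgebra.comul (R := k) (A := B)) = (Bialgebra.comulAlgHom k B).toLinearMap := rfl
  have hε : (Coalgebra.counit (R := k) (A := B)) = (Bialgebra.counitAlgHom k B).toLinearMap := rfl
  refine ⟨⟨?_, ?_⟩, hcomp⟩
  · intro n
    obtain ⟨x, m, rfl⟩ := hgen n
    have hc := hρS.coassoc x
    have hm := hM.coassoc m
    rw [hcomp, HopfLoc.act_coact ρS.toLinearMap ρN hcomp, hc, hNf, hΔ,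
      HopfLoc.act_map (LinearMap.id : Q →ₗ[k] Q) (LinearMap.id : N →ₗ[k] N) (fun _ _ => rfl)]
    congr 1
    rw [← hΔ]
    have a1 : TensorProduct.map ρN LinearMap.id (g m) =
        TensorProduct.map (TensorProduct.map f LinearMap.id) LinearMap.id
          (TensorProduct.map ρM (LinearMap.id : B →ₗ[k] B) (ρM m)) := by
      have b1 : ρN ∘ₗ f = TensorProduct.map f LinearMap.id ∘ₗ ρM := LinearMap.ext hNf
      rw [← hgdef]
      generalize ρM m = z
      induction z with
      | zero => simp
      | add x y hx hy => simp only [map_add, hx, hy]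
      | tmul a b =>
        have b2 := LinearMap.congr_fun b1 a
        simp only [LinearMap.comp_apply] at b2
        simp only [TensorProduct.map_tmul, LinearMap.id_apply, b2]
    have a2 : ∀ z : (M ⊗[k] B) ⊗[k] B, TensorProduct.assoc k N B B
        (TensorProduct.map (TensorProduct.map f LinearMap.id) LinearMap.id z) =
        TensorProduct.map f LinearMap.id (TensorProduct.assoc k M B B z) := by
      intro z
      have : (TensorProduct.assoc k N B B).toLinearMap ∘ₗ
        (TensorProduct.map (TensorProduct.map f LinearMap.id) LinearMap.id) =
        TensorProduct.map f LinearMap.id ∘ₗ (TensorProduct.assoc k M B B).toLinearMap := by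
        ext a b c
        simp
      exact LinearMap.congr_fun this z
    rw [a1, a2, hm]
    rw [← hgdef]
    generalize ρM m = z
    induction z with
    | zero => simp
    | add x y hx hy => simp only [map_add, hx, hy]
    | tmul a b => simp
  · intro n
    obtain ⟨x, m, rfl⟩ := hgen n
    have hc := hρS.counit x
    have hm := hM.counit m
    rw [hcomp, hNf, hε,
      HopfLoc.act_map (LinearMap.id : Q →ₗ[k] Q) (LinearMap.id : N →ₗ[k] N) (fun _ _ => rfl),
      HopfLoc.act_rid, ← hε, hc]
    congr 1
    have a2 : ∀ z : M ⊗[k] B, TensorProduct.rid k N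
        (TensorProduct.map LinearMap.id (Coalgebra.counit (R := k) (A := B))
          (TensorProduct.map f LinearMap.id z)) =
        f (TensorProduct.rid k M
          (TensorProduct.map LinearMap.id (Coalgebra.counit (R := k) (A := B)) z)) := by
      intro z
      induction z with
      | zero => simp
      | add x y hx hy => simp only [map_add, hx, hy]
      | tmul a b => simp
    rw [← hgdef, a2, hm]
end

section
/- Rigidity of Hopf algebras under compatible localization: Let k be a field and G a Hopf algebra over k, regarded as a right G-comodule algebra via its comultiplication Δ. Let T be a left Ore set in G which is Δ-compatible, i.e. there exists a k-algebra homomorphism Δ_T : T⁻¹G → (T⁻¹G) ⊗ G making T⁻¹G a right G-comodule algebra and satisfying Δ_T ∘ i_T = (i_T ⊗ id_G) ∘ Δ. Then either T⁻¹G = 0 or the localization map i_T : G → T⁻¹G is bijective; in other words, no nontrivial Ore localization of a Hopf algebra admits a multiplicative extension of the comultiplication to a coaction on the localization. -/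
open scoped TensorProduct

section Helpers

variable {k : Type*} [Field k] {G : Type*} [Ring G] [HopfAlgebra k G]
  {Q : Type*} [Ring Q] [Algebra k Q]

open Coalgebra HopfAlgebra in
/-- `q ⊗ h ↦ q * i (S h)` -/
noncomputable def auxM (i : G →ₐ[k] Q) : Q ⊗[k] G →ₗ[k] Q :=
  LinearMap.mul' k Q ∘ₗ TensorProduct.map LinearMap.id (i.toLinearMap ∘ₗ antipode k)

lemma auxM_tmul (i : G →ₐ[k] Q) (q : Q) (h : G) :
    auxM i (q ⊗ₜ[k] h) = q * i (HopfAlgebra.antipode k h) := by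
  simp [auxM]

lemma auxM_mul (i : G →ₐ[k] Q) (x : Q ⊗[k] G) (g : G) :
    auxM i (x * Algebra.TensorProduct.map i (AlgHom.id k G) (Bialgebra.comulAlgHom k G g))
      = Coalgebra.counit (R := k) g • auxM i x := by
  induction x with
  | zero => simp
  | add x y hx hy => rw [add_mul, map_add, hx, hy, map_add, smul_add]
  | tmul q h =>
    have h1 := HopfAlgebra.sum_mul_antipode_eq_smul (Coalgebra.Repr.arbitrary k g)
    have h2 := congrArg (fun z => q * (i z * i (HopfAlgebra.antipode k h))) h1
    rw [Bialgebra.comulAlgHom_apply, ← (Coalgebra.Repr.arbitrary k g).eq]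
    simp only [map_sum, Finset.mul_sum, Finset.sum_mul, map_mul, map_smul, map_one,
      smul_mul_assoc, mul_smul_comm, one_mul] at h2
    simp only [map_sum, Finset.mul_sum, Algebra.TensorProduct.map_tmul,
      Algebra.TensorProduct.tmul_mul_tmul, auxM_tmul, AlgHom.id_apply,
      HopfAlgebra.antipode_mul_antidistrib, map_mul]
    rw [← h2]
    simp only [mul_assoc]

/-- `q ⊗ h ↦ F q • h` -/
noncomputable def auxF (F : Q →ₗ[k] k) : Q ⊗[k] G →ₗ[k] G :=
  (TensorProduct.lid k G).toLinearMap ∘ₗ TensorProduct.map F LinearMap.id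

lemma auxF_tmul (F : Q →ₗ[k] k) (q : Q) (h : G) : auxF F (q ⊗ₜ[k] h) = F q • h := by
  simp [auxF]

lemma auxF_mul (i : G →ₐ[k] Q) (F : Q →ₗ[k] k)
    (hF : ∀ q g, F (q * i g) = Coalgebra.counit (R := k) g * F q) (x : Q ⊗[k] G) (g : G) :
    auxF F (x * Algebra.TensorProduct.map i (AlgHom.id k G) (Bialgebra.comulAlgHom k G g))
      = auxF F x * g := by
  induction x with
  | zero => simp
  | add x y hx hy => rw [add_mul, map_add, hx, hy, map_add, add_mul]
  | tmul q h =>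
    have h1 := Coalgebra.sum_counit_smul (Coalgebra.Repr.arbitrary k g)
    have h2 := congrArg (fun z => F q • (h * z)) h1
    rw [Bialgebra.comulAlgHom_apply, ← (Coalgebra.Repr.arbitrary k g).eq]
    simp only [Finset.mul_sum, Finset.smul_sum, mul_smul_comm] at h2
    simp only [map_sum, Finset.mul_sum, Algebra.TensorProduct.map_tmul,
      Algebra.TensorProduct.tmul_mul_tmul, auxF_tmul, AlgHom.id_apply, hF, smul_mul_assoc]
    rw [← h2]
    refine Finset.sum_congr rfl fun j _ => ?_
    rw [mul_comm, mul_smul]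

end Helpers

/-- **Rigidity of Hopf algebras under compatible localization.** Let `G` be a Hopf algebra
over a field `k`, regarded as a right `G`-comodule algebra via its comultiplication `Δ`.
If `T` is a left Ore set in `G` which is `Δ`-compatible — i.e. there is a `k`-algebra map
`ΔT : T⁻¹G → T⁻¹G ⊗ G` making `T⁻¹G` a right `G`-comodule algebra with
`ΔT ∘ i_T = (i_T ⊗ id) ∘ Δ` — then either `T⁻¹G = 0` or the localization map
`i_T : G → T⁻¹G` is bijective. -/
theorem hopf_algebra_localization_rigidity
    {k : Type*} [Field k] {G : Type*} [Ring G] [HopfAlgebra k G]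
    {T : Set G} (hT : IsLeftOreSet T)
    {Q : Type*} [Ring Q] [Algebra k Q]
    (iT : G →ₐ[k] Q) (hloc : IsLeftOreRingLocalization T iT.toRingHom)
    (ΔT : Q →ₐ[k] Q ⊗[k] G) (hcomod : IsComoduleAlgebra k G ΔT)
    (hcompat : ∀ x : G,
      ΔT (iT x) = Algebra.TensorProduct.map iT (AlgHom.id k G) (Bialgebra.comulAlgHom k G x)) :
    (∀ x : Q, x = 0) ∨ Function.Bijective iT := by
  by_cases h10 : (1 : Q) = 0
  · left
    intro x
    rw [← one_mul x, h10, zero_mul]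
  right
  obtain ⟨f, hf⟩ : ∃ f : Q →ₗ[k] k, f 1 = 1 := by
    obtain ⟨f, hf⟩ := LinearMap.exists_leftInverse_of_injective
      (LinearMap.toSpanSingleton k Q 1) (LinearMap.ker_toSpanSingleton k h10)
    refine ⟨f, ?_⟩
    have := LinearMap.congr_fun hf 1
    simpa using this
  let F : Q →ₗ[k] k := f ∘ₗ auxM iT ∘ₗ ΔT.toLinearMap
  have hF1 : F 1 = 1 := by
    simp [F, Algebra.TensorProduct.one_def, auxM_tmul, HopfAlgebra.antipode_one, hf]
  have hF : ∀ q g, F (q * iT g) = Coalgebra.counit (R := k) g * F q := by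
    intro q g
    simp only [F, LinearMap.comp_apply, AlgHom.toLinearMap_apply, map_mul]
    rw [hcompat, auxM_mul, map_smul, smul_eq_mul]
  let p : Q → G := fun q => auxF F (ΔT q)
  have hp : ∀ q g, p (q * iT g) = p q * g := by
    intro q g
    simp only [p, map_mul]
    rw [hcompat, auxF_mul iT F hF]
  have hp1 : p 1 = 1 := by
    simp [p, Algebra.TensorProduct.one_def, auxF_tmul, hF1]
  have hpi : ∀ g, p (iT g) = g := by
    intro g
    have := hp 1 g
    rwa [one_mul, hp1, one_mul] at this
  refine ⟨Function.LeftInverse.injective hpi, ?_⟩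
  intro x
  obtain ⟨s, hs, r, hr⟩ := hloc.surj x
  obtain ⟨v, hv⟩ := hloc.isUnit s hs
  change (v : Q) = iT s at hv
  change iT s * x = iT r at hr
  have h1 : p (↑v⁻¹ : Q) * s = 1 := by
    rw [← hp, ← hv, Units.inv_mul, hp1]
  refine ⟨p (↑v⁻¹ : Q) * r, ?_⟩
  rw [map_mul, ← hr, ← mul_assoc, ← map_mul, h1, map_one, one_mul]
end

section
/- Unique extension of derivations to Ore localizations: Let R be a domain (a unital ring without zero divisors), S a left Ore set in R, and d : R → R an additive map satisfying the Leibniz rule d(rr') = d(r)r' + r·d(r') for all r, r' ∈ R. Then there exists a unique additive map d_S : S⁻¹R → S⁻¹R satisfying the Leibniz rule d_S(xy) = d_S(x)y + x·d_S(y) for all x, y ∈ S⁻¹R and extending d, i.e. d_S ∘ i_S = i_S ∘ d. -/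
/-- **Unique extension of derivations to Ore localizations.** Let `R` be a domain,
`S` a left Ore set in `R`, and `d : R → R` an additive map satisfying the Leibniz rule.
Then there is a unique additive map `dS : S⁻¹R → S⁻¹R` satisfying the Leibniz rule and
extending `d` along the localization map `i : R → S⁻¹R`. -/
theorem derivation_extends_uniquely_to_ore_localization
    {R : Type*} [Ring R] [IsDomain R]
    {S : Set R} (hS : IsLeftOreSet S)
    {Q : Type*} [Ring Q] (i : R →+* Q) (hloc : IsLeftOreRingLocalization S i)
    (d : R →+ R) (hd : ∀ r r' : R, d (r * r') = d r * r' + r * d r') :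
    ∃! dS : Q →+ Q,
      (∀ x y : Q, dS (x * y) = dS x * y + x * dS y) ∧ ∀ r : R, dS (i r) = i (d r) := by
  have inj : ∀ r : R, i r = 0 → r = 0 := by
    intro r hr
    obtain ⟨s, hs, h⟩ := (hloc.ker r).1 hr
    rcases mul_eq_zero.1 h with h | h
    · exact absurd (h ▸ hs) hS.zero_not_mem
    · exact h
  have inj2 : ∀ a b : R, i a = i b → a = b := by
    intro a b h
    exact sub_eq_zero.1 (inj _ (by rw [map_sub, h, sub_self]))
  have canc : ∀ s ∈ S, ∀ x y : Q, i s * x = i s * y → x = y := by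
    intro s hs x y h
    exact (hloc.isUnit s hs).mul_left_cancel h
  have key : ∀ x : Q, ∃ y : Q, ∀ a b : R, i a * x = i b →
      i a * y = i (d b) - i (d a) * x := by
    intro x
    obtain ⟨s, hs, r, hsr⟩ := hloc.surj x
    obtain ⟨u, hu⟩ := hloc.isUnit s hs
    refine ⟨↑u⁻¹ * (i (d r) - i (d s) * x), ?_⟩
    have hy : i s * (↑u⁻¹ * (i (d r) - i (d s) * x)) = i (d r) - i (d s) * x := by
      rw [← hu, Units.mul_inv_cancel_left]
    generalize (↑u⁻¹ * (i (d r) - i (d s) * x) : Q) = y at hy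
    intro a b hab
    obtain ⟨s', hs', r', h⟩ := hS.ore s hs a
    have h1 : r' * r = s' * b := by
      apply inj2
      rw [map_mul, map_mul, ← hsr, ← hab, ← mul_assoc, ← mul_assoc, ← map_mul, ← map_mul, h]
    have e1 := congrArg (fun z => i (d z)) h1
    have e2 := congrArg (fun z => i (d z)) h
    simp only [hd, map_add, map_mul] at e1 e2
    have e3 : i r' * i s = i s' * i a := by rw [← map_mul, h, map_mul]
    apply canc s' hs'
    have f1 : i r' * i (d r) = i (d s') * i b + i s' * i (d b) - i (d r') * i r :=
      eq_sub_of_add_eq' e1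
    have f2 : i r' * i (d s) = i (d s') * i a + i s' * i (d a) - i (d r') * i s :=
      eq_sub_of_add_eq' e2
    rw [← mul_assoc, ← e3, mul_assoc, hy, mul_sub, ← mul_assoc, f1, f2, ← hab, ← hsr]
    noncomm_ring
  choose D hD using key
  have hadd : ∀ x y, D (x + y) = D x + D y := by
    intro x y
    obtain ⟨s, hs, r, hx⟩ := hloc.surj x
    obtain ⟨t, ht, q, hy⟩ := hloc.surj y
    obtain ⟨s', hs', r', h⟩ := hS.ore s hs t
    have hx' : i (s' * t) * x = i (r' * r) := by rw [← h, map_mul, mul_assoc, hx, map_mul]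
    have hy' : i (s' * t) * y = i (s' * q) := by rw [map_mul, mul_assoc, hy, map_mul]
    apply canc _ (hS.mul_mem hs' ht)
    rw [hD (x + y) _ (r' * r + s' * q) (by rw [mul_add, hx', hy', map_add]), mul_add (i (s' * t)) (D x),
      hD x _ _ hx', hD y _ _ hy', map_add, map_add]
    noncomm_ring
  refine ⟨AddMonoidHom.mk' D hadd, ⟨?_, ?_⟩, ?_⟩
  · intro x y
    change D (x * y) = D x * y + x * D y
    obtain ⟨s, hs, r, hx⟩ := hloc.surj x
    obtain ⟨t, ht, q, hy⟩ := hloc.surj y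
    obtain ⟨s', hs', r', h⟩ := hS.ore t ht r
    have hx' : i (s' * s) * x = i (r' * t) := by rw [h, map_mul, mul_assoc, hx, map_mul]
    have hy' : i (r' * t) * y = i (r' * q) := by rw [map_mul, mul_assoc, hy, map_mul]
    apply canc _ (hS.mul_mem hs' hs)
    rw [hD (x * y) _ (r' * q) (by rw [← mul_assoc, hx', hy']), mul_add, ← mul_assoc _ (D x),
      ← mul_assoc _ x (D y), hx', hD x _ _ hx', hD y _ _ hy']
    noncomm_ring
  · intro r
    change D (i r) = i (d r)
    have d1 : d 1 = 0 := by simpa using hd 1 1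
    simpa [d1] using hD (i r) 1 r (by simp)
  · rintro E ⟨hE, hEi⟩
    ext x
    change E x = D x
    obtain ⟨s, hs, r, hx⟩ := hloc.surj x
    apply canc s hs
    rw [hD x s r hx, ← hEi, ← hEi, ← hx, hE]
    noncomm_ring
end
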